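/- arXiv:2507.15505 — 2 statements merged into one kernel-verified Lean document; each statement's English description precedes it below -/
import Mathlib

section
/- Let r be a positive integer with r ≢ 0 (mod p) and r ≢ −1 (mod p). Suppose ι: K → V is an injective homomorphism of KG-modules (K the trivial module). If there is a KG-module homomorphism φ: Sym^r V → Sym^{r−1} V with φ ∘ mul_{r−1} = id, then there is a KG-module homomorphism θ: Sym^{r+1} V → Sym^r V with θ ∘ mul_r = id. -/
open MvPolynomial

/-- The chain rule for partial derivatives under an algebra homomorphism. -/
theorem MvPolynomial.pderiv_algHom {K σ τ : Type*} [CommSemiring K] [Fintype σ]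
    (e : MvPolynomial σ K →ₐ[K] MvPolynomial τ K) (i : τ) (f : MvPolynomial σ K) :
    pderiv i (e f) = ∑ j, e (pderiv j f) * pderiv i (e (X j)) := by
  classical
  induction f using MvPolynomial.induction_on with
  | C a =>
    have h : e (C a) = C a := e.commutes a
    simp [h]
  | add f g hf hg => simp [hf, hg, add_mul, Finset.sum_add_distrib]
  | mul_X f k hf =>
    simp only [map_mul, Derivation.leibniz, smul_eq_mul, map_add, hf, add_mul,
      Finset.sum_add_distrib, pderiv_X, Finset.mul_sum]
    congr 1
    · simp [Pi.single_apply, apply_ite e]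
    · exact Finset.sum_congr rfl fun j _ => by ring

/-- The partial derivatives of a form of degree one are constants. -/
theorem MvPolynomial.IsHomogeneous.pderiv_eq_C {K σ : Type*} [CommSemiring K]
    {f : MvPolynomial σ K} (hf : f.IsHomogeneous 1) (i : σ) :
    pderiv i f = C (coeff 0 (pderiv i f)) := by
  have h : (pderiv i f).IsHomogeneous 0 := hf.pderiv
  exact totalDegree_eq_zero_iff_eq_C.mp (Nat.le_zero.mp h.totalDegree_le)

/-- The operator `f ↦ ∑ i, x_i φ(∂f/∂x_i)`, the composite of polarization
`Sym^{r+1} V → V ⊗ Sym^r V`, the map `φ` on the second factor, and multiplication. -/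
noncomputable def polarizedMap {K σ : Type*} [CommSemiring K] [Fintype σ]
    (φ : MvPolynomial σ K →ₗ[K] MvPolynomial σ K) : MvPolynomial σ K →ₗ[K] MvPolynomial σ K :=
  ∑ i, LinearMap.mulLeft K (X i) ∘ₗ φ ∘ₗ (pderiv i).toLinearMap

theorem polarizedMap_apply {K σ : Type*} [CommSemiring K] [Fintype σ]
    (φ : MvPolynomial σ K →ₗ[K] MvPolynomial σ K) (f : MvPolynomial σ K) :
    polarizedMap φ f = ∑ i, X i * φ (pderiv i f) := by
  simp [polarizedMap]

section

variable {K σ : Type*} [CommSemiring K] [Fintype σ] {φ : MvPolynomial σ K →ₗ[K] MvPolynomial σ K}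
  {r : ℕ}

theorem polarizedMap_isHomogeneous
    (hφ : ∀ f : MvPolynomial σ K, f.IsHomogeneous (r + 1) → (φ f).IsHomogeneous r)
    {f : MvPolynomial σ K} (hf : f.IsHomogeneous (r + 2)) :
    (polarizedMap φ f).IsHomogeneous (r + 1) := by
  rw [polarizedMap_apply]
  refine IsHomogeneous.sum _ _ _ fun i _ => ?_
  rw [add_comm r 1]
  exact (isHomogeneous_X K i).mul (hφ _ hf.pderiv)

theorem polarizedMap_algHom (e : MvPolynomial σ K →ₐ[K] MvPolynomial σ K)
    (he : ∀ i, (e (X i)).IsHomogeneous 1)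
    (hφ : ∀ f : MvPolynomial σ K, f.IsHomogeneous r → φ (e f) = e (φ f))
    {f : MvPolynomial σ K} (hf : f.IsHomogeneous (r + 1)) :
    polarizedMap φ (e f) = e (polarizedMap φ f) := by
  have key (i : σ) : φ (pderiv i (e f)) =
      ∑ j, pderiv i (e (X j)) * e (φ (pderiv j f)) := by
    rw [pderiv_algHom, map_sum]
    refine Finset.sum_congr rfl fun j _ => ?_
    rw [(he j).pderiv_eq_C i, mul_comm, C_mul', map_smul, hφ _ hf.pderiv, C_mul']
  simp only [polarizedMap_apply, key, map_sum, map_mul, Finset.mul_sum]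
  rw [Finset.sum_comm]
  refine Finset.sum_congr rfl fun j _ => ?_
  have euler := (he j).sum_X_mul_pderiv
  rw [one_smul] at euler
  simp only [← mul_assoc, ← Finset.sum_mul, euler]

theorem polarizedMap_mul {w : MvPolynomial σ K} (hw : w.IsHomogeneous 1)
    (hφ : ∀ f : MvPolynomial σ K, f.IsHomogeneous r → φ (w * f) = f)
    {f : MvPolynomial σ K} (hf : f.IsHomogeneous (r + 1)) :
    polarizedMap φ (w * f) = (r + 1) • f + w * φ f := by
  have key (i : σ) : X i * φ (pderiv i (w * f)) =
      X i * pderiv i f + X i * pderiv i w * φ f := by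
    rw [Derivation.leibniz, smul_eq_mul, smul_eq_mul, map_add, hφ _ hf.pderiv, mul_comm f,
      hw.pderiv_eq_C i, C_mul', map_smul, mul_add, mul_assoc, C_mul']
  have euler := hw.sum_X_mul_pderiv
  rw [one_smul] at euler
  simp only [polarizedMap_apply, key, Finset.sum_add_distrib, ← Finset.sum_mul, euler,
    hf.sum_X_mul_pderiv]

end

theorem stmt1 {K : Type*} [Field K] {p : ℕ} (hp : p.Prime) [CharP K p]
    {G : Type*} [Group G] {t : ℕ}
    (ρ : G →* (MvPolynomial (Fin t) K ≃ₐ[K] MvPolynomial (Fin t) K))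
    (hρ : ∀ (g : G) (i : Fin t), (ρ g) (X i) ∈ homogeneousSubmodule (Fin t) K 1)
    -- `w₀ = ι(1)`, the image of `1 ∈ K` under the injective `KG`-map `ι : K → V`
    (w₀ : MvPolynomial (Fin t) K) (hw₀ : w₀ ∈ homogeneousSubmodule (Fin t) K 1)
    (hw₀ne : w₀ ≠ 0) (hw₀inv : ∀ g : G, (ρ g) w₀ = w₀)
    {r : ℕ} (hr : 0 < r) (hr0 : ¬ p ∣ r) (hr1 : ¬ p ∣ (r + 1))
    (φ : MvPolynomial (Fin t) K →ₗ[K] MvPolynomial (Fin t) K)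
    (hφmem : ∀ f ∈ homogeneousSubmodule (Fin t) K r,
      φ f ∈ homogeneousSubmodule (Fin t) K (r - 1))
    (hφequiv : ∀ (g : G), ∀ f ∈ homogeneousSubmodule (Fin t) K r,
      φ ((ρ g) f) = (ρ g) (φ f))
    (hφsplit : ∀ f ∈ homogeneousSubmodule (Fin t) K (r - 1), φ (w₀ * f) = f) :
    ∃ θ : MvPolynomial (Fin t) K →ₗ[K] MvPolynomial (Fin t) K,
      (∀ f ∈ homogeneousSubmodule (Fin t) K (r + 1),
        θ f ∈ homogeneousSubmodule (Fin t) K r) ∧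
      (∀ (g : G), ∀ f ∈ homogeneousSubmodule (Fin t) K (r + 1), θ ((ρ g) f) = (ρ g) (θ f)) ∧
      (∀ f ∈ homogeneousSubmodule (Fin t) K r, θ (w₀ * f) = f) := by
  obtain ⟨s, rfl⟩ := Nat.exists_eq_add_one.mpr hr
  rw [Nat.add_sub_cancel] at hφmem hφsplit
  have h0 : ((s + 1 : ℕ) : K) ≠ 0 := by rwa [Ne, CharP.cast_eq_zero_iff K p]
  have h1 : ((s + 1 + 1 : ℕ) : K) ≠ 0 := by rwa [Ne, CharP.cast_eq_zero_iff K p]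
  -- On degree `r` the polarized map composed with `mul` is `r + e` for the idempotent
  -- `e = mul ∘ φ`, with inverse `r⁻¹ (1 - (r + 1)⁻¹ e)`.
  have hD {f} (hf : f ∈ homogeneousSubmodule (Fin t) K (s + 1 + 1)) :
      polarizedMap φ f ∈ homogeneousSubmodule (Fin t) K (s + 1) :=
    polarizedMap_isHomogeneous hφmem hf
  have hmul {f} (hf : f ∈ homogeneousSubmodule (Fin t) K s) :
      w₀ * f ∈ homogeneousSubmodule (Fin t) K (s + 1) := by
    rw [add_comm s 1]
    exact IsHomogeneous.mul hw₀ hf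
  let θ : MvPolynomial (Fin t) K →ₗ[K] MvPolynomial (Fin t) K :=
    ((s + 1 : ℕ) : K)⁻¹ • (LinearMap.id - ((s + 1 + 1 : ℕ) : K)⁻¹ • LinearMap.mulLeft K w₀ ∘ₗ φ) ∘ₗ
      polarizedMap φ
  have hθ (f) : θ f = ((s + 1 : ℕ) : K)⁻¹ • (polarizedMap φ f -
      ((s + 1 + 1 : ℕ) : K)⁻¹ • (w₀ * φ (polarizedMap φ f))) := rfl
  refine ⟨θ, fun f hf => ?_, fun g f hf => ?_, fun f hf => ?_⟩
  · rw [hθ]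
    exact Submodule.smul_mem _ _ <| Submodule.sub_mem _ (hD hf) <|
      Submodule.smul_mem _ _ (hmul (hφmem _ (hD hf)))
  · have h : polarizedMap φ (ρ g f) = ρ g (polarizedMap φ f) :=
      polarizedMap_algHom (ρ g).toAlgHom (hρ g) (hφequiv g) hf
    rw [hθ, hθ, h, hφequiv g _ (hD hf)]
    simp only [map_smul, map_sub, map_mul, hw₀inv]
  · rw [hθ, polarizedMap_mul hw₀ hφsplit hf, map_add, map_nsmul, hφsplit _ (hφmem _ hf),
      inv_smul_eq_iff₀ h0, sub_eq_iff_eq_add, ← Nat.cast_smul_eq_nsmul K, ← succ_nsmul,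
      ← Nat.cast_smul_eq_nsmul K, mul_smul_comm, inv_smul_smul₀ h1]
end

section
/- Let r be a positive integer, let ε: V → K be a surjective KG-homomorphism, and let φ: Sym^{r−1} V → Sym^r V be a KG-module homomorphism with ∂_r ∘ φ = id. Define Ψ(φ) to be the K-linear operator Σ_{α ∈ Com_t(r−1)} φ(x^α) · ∂^α/α! on K[x_1, …, x_t]. Then the commutator ∂ ∘ Ψ(φ) − Ψ(φ) ∘ ∂ maps every homogeneous polynomial f of degree d to C(d, r−1)·f, where C(d, r−1) is the binomial coefficient regarded as an element of K. -/
open MvPolynomial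

/-- The derivation `∂ = Σ_i ε(x_i)·∂/∂x_i` on `K[x_1,…,x_t]`, where `c i = ε(x_i)`. -/
noncomputable def Dc {K : Type*} [Field K] {t : ℕ} (c : Fin t → K) :
    MvPolynomial (Fin t) K →ₗ[K] MvPolynomial (Fin t) K :=
  ∑ i, c i • (pderiv i).toLinearMap

/-- Interpret a tuple of exponents as a finitely supported function. -/
noncomputable def toFS {t : ℕ} (α : Fin t → ℕ) : Fin t →₀ ℕ :=
  Finsupp.equivFunOnFinite.symm α

/-- The Chu–Vandermonde identity for a tuple of upper arguments. -/
theorem sum_antidiagonalTuple_prod_choose {t : ℕ} (b : Fin t → ℕ) (n : ℕ) :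
    ∑ a ∈ Finset.Nat.antidiagonalTuple t n, ∏ i, (b i).choose (a i) = (∑ i, b i).choose n := by
  induction t generalizing n with
  | zero => cases n <;> simp
  | succ t ih =>
    rw [Fin.sum_univ_succ, Nat.add_choose_eq]
    simp_rw [← ih (fun i => b i.succ), Finset.mul_sum]
    rw [Finset.sum_sigma']
    refine Finset.sum_bij' (fun a _ => ⟨(a 0, ∑ i : Fin t, a i.succ), fun i => a i.succ⟩)
      (fun s _ => Fin.cons s.1.1 s.2) ?_ ?_ ?_ ?_ ?_
    · intro a ha
      simpa [Finset.Nat.mem_antidiagonalTuple, Fin.sum_univ_succ] using ha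
    · rintro ⟨⟨m, k⟩, a⟩ h
      simp_all [Finset.Nat.mem_antidiagonalTuple, Fin.sum_univ_succ]
    · intro a _
      exact Fin.cons_self_tail a
    · rintro ⟨⟨m, k⟩, a⟩ h
      simp_all [Finset.Nat.mem_antidiagonalTuple]
    · intro a _
      rw [Fin.prod_univ_succ]

theorem Dc_mul {K : Type*} [Field K] {t : ℕ} (c : Fin t → K) (f g : MvPolynomial (Fin t) K) :
    Dc c (f * g) = Dc c f * g + f * Dc c g := by
  simp only [Dc, LinearMap.sum_apply, LinearMap.smul_apply,
    Derivation.coeFn_coe, Derivation.leibniz, smul_eq_mul, Finset.sum_mul, Finset.mul_sum,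
    ← Finset.sum_add_distrib]
  refine Finset.sum_congr rfl fun i _ => ?_
  simp only [MvPolynomial.smul_eq_C_mul]
  ring

theorem mul_choose_pred (n k : ℕ) : n * (n - 1).choose k = n.choose k * (n - k) := by
  cases n with
  | zero => simp
  | succ n => rw [mul_comm, Nat.add_sub_cancel, Nat.choose_mul_succ_eq]

/-- A divided-power differential operator commutes with the partial derivatives. -/
theorem dividedPower_pderiv {K : Type*} [Field K] {t : ℕ} (a : Fin t → ℕ)
    (D : MvPolynomial (Fin t) K →ₗ[K] MvPolynomial (Fin t) K)
    (hD : ∀ (β : Fin t →₀ ℕ) (k : K), D (monomial β k) =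
      (∏ i, ((β i).choose (a i) : K)) • monomial (toFS fun i => β i - a i) k)
    (i : Fin t) (f : MvPolynomial (Fin t) K) :
    D (pderiv i f) = pderiv i (D f) := by
  induction f using MvPolynomial.induction_on' with
  | add f g hf hg => simp only [map_add, hf, hg]
  | monomial β k =>
    rw [hD, Derivation.map_smul, pderiv_monomial, pderiv_monomial, hD, smul_monomial,
      smul_monomial]
    have hexp : (toFS fun j => (β - Finsupp.single i 1 : Fin t →₀ ℕ) j - a j) =
        (toFS fun j => β j - a j) - Finsupp.single i 1 := by
      ext j
      simp [toFS, Nat.sub_right_comm]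
    have hcoeff : β i * ∏ j, ((β - Finsupp.single i 1 : Fin t →₀ ℕ) j).choose (a j) =
        (∏ j, (β j).choose (a j)) * (β i - a i) := by
      rw [← Finset.mul_prod_erase _ _ (Finset.mem_univ i),
        ← Finset.mul_prod_erase _ (fun j => (β j).choose (a j)) (Finset.mem_univ i), ← mul_assoc,
        Finsupp.tsub_apply, Finsupp.single_eq_same, mul_choose_pred,
        mul_right_comm _ _ (β i - a i)]
      congr 1
      refine Finset.prod_congr rfl fun j hj => ?_
      rw [Finsupp.tsub_apply, Finsupp.single_eq_of_ne (Finset.ne_of_mem_erase hj), Nat.sub_zero]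
    have hcast := congrArg (Nat.cast : ℕ → K) hcoeff
    simp only [Nat.cast_mul, Nat.cast_prod] at hcast
    rw [hexp]
    congr 1
    have hval : (toFS fun j => β j - a j) i = β i - a i := rfl
    rw [hval, smul_eq_mul, smul_eq_mul]
    linear_combination k * hcast

theorem dividedPower_Dc {K : Type*} [Field K] {t : ℕ} (c : Fin t → K) (a : Fin t → ℕ)
    (D : MvPolynomial (Fin t) K →ₗ[K] MvPolynomial (Fin t) K)
    (hD : ∀ (β : Fin t →₀ ℕ) (k : K), D (monomial β k) =
      (∏ i, ((β i).choose (a i) : K)) • monomial (toFS fun i => β i - a i) k)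
    (f : MvPolynomial (Fin t) K) :
    D (Dc c f) = Dc c (D f) := by
  simp [Dc, dividedPower_pderiv a D hD]

/-- Multiplying a divided-power derivative of a monomial back by `x^a` scales that monomial. -/
theorem monomial_mul_dividedPower {K : Type*} [Field K] {t : ℕ} (a : Fin t → ℕ)
    (β : Fin t →₀ ℕ) (k : K) :
    monomial (toFS a) (1 : K) *
        ((∏ i, ((β i).choose (a i) : K)) • monomial (toFS fun i => β i - a i) k) =
      (∏ i, ((β i).choose (a i) : K)) • monomial β k := by
  by_cases h : ∀ i, a i ≤ β i
  · have hβ : toFS a + (toFS fun i => β i - a i) = β := by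
      ext i
      simp [toFS, h i]
    rw [mul_smul_comm, monomial_mul, one_mul, hβ]
  · obtain ⟨i, hi⟩ := not_forall.mp h
    have hzero : ∏ i, ((β i).choose (a i) : K) = 0 :=
      Finset.prod_eq_zero (Finset.mem_univ i) (by
        rw [Nat.choose_eq_zero_of_lt (not_le.mp hi), Nat.cast_zero])
    simp [hzero]

/-- The operator `Σ_a x^a · ∂^a/a!`, over the exponents `a` of degree `n`, multiplies a homogeneous
polynomial of degree `d` by `C(d, n)`. -/
theorem sum_monomial_mul_dividedPower {K : Type*} [Field K] {t : ℕ}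
    (Dop : (Fin t → ℕ) → (MvPolynomial (Fin t) K →ₗ[K] MvPolynomial (Fin t) K))
    (hDop : ∀ (a : Fin t → ℕ) (β : Fin t →₀ ℕ) (k : K), Dop a (monomial β k) =
      (∏ i, ((β i).choose (a i) : K)) • monomial (toFS fun i => β i - a i) k)
    (n d : ℕ) {f : MvPolynomial (Fin t) K} (hf : f.IsHomogeneous d) :
    ∑ a ∈ Finset.Nat.antidiagonalTuple t n, monomial (toFS a) (1 : K) * Dop a f =
      (d.choose n : K) • f := by
  rw [f.as_sum]
  simp only [map_sum, Finset.mul_sum, Finset.smul_sum]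
  rw [Finset.sum_comm]
  refine Finset.sum_congr rfl fun β hβ => ?_
  have hdeg : ∑ i, β i = d := by
    rw [← Finsupp.degree_eq_sum, Finsupp.degree_eq_weight_one]
    exact hf (mem_support_iff.mp hβ)
  simp only [hDop, monomial_mul_dividedPower]
  rw [← Finset.sum_smul, ← hdeg, ← sum_antidiagonalTuple_prod_choose]
  push_cast
  rfl

theorem stmt4 {K : Type*} [Field K] {p : ℕ} (hp : p.Prime) [CharP K p]
    {G : Type*} [Group G] {t : ℕ}
    (ρ : G →* (MvPolynomial (Fin t) K ≃ₐ[K] MvPolynomial (Fin t) K))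
    (hρ : ∀ (g : G) (i : Fin t), (ρ g) (X i) ∈ homogeneousSubmodule (Fin t) K 1)
    (c : Fin t → K)
    (hsurj : Function.Surjective fun v : homogeneousSubmodule (Fin t) K 1 =>
      aeval c (v : MvPolynomial (Fin t) K))
    (hequiv : ∀ (g : G), ∀ f ∈ homogeneousSubmodule (Fin t) K 1,
      aeval c ((ρ g) f) = aeval c f)
    {r : ℕ} (hr : 0 < r)
    (φ : MvPolynomial (Fin t) K →ₗ[K] MvPolynomial (Fin t) K)
    (hφmem : ∀ f ∈ homogeneousSubmodule (Fin t) K (r - 1),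
      φ f ∈ homogeneousSubmodule (Fin t) K r)
    (hφequiv : ∀ (g : G), ∀ f ∈ homogeneousSubmodule (Fin t) K (r - 1),
      φ ((ρ g) f) = (ρ g) (φ f))
    (hφsplit : ∀ f ∈ homogeneousSubmodule (Fin t) K (r - 1), Dc c (φ f) = f)
    -- `Dop α` is the divided-power differential operator `∂^α/α!`
    (Dop : (Fin t → ℕ) → (MvPolynomial (Fin t) K →ₗ[K] MvPolynomial (Fin t) K))
    (hDop : ∀ (α : Fin t → ℕ) (β : Fin t →₀ ℕ) (cc : K),
      Dop α (monomial β cc) =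
        (∏ i, ((β i).choose (α i) : K)) • monomial (toFS fun i => β i - α i) cc)
    -- `Ψ(φ) = Σ_{α ∈ Com_t(r-1)} φ(x^α)·∂^α/α!`
    (Ψ : MvPolynomial (Fin t) K →ₗ[K] MvPolynomial (Fin t) K)
    (hΨ : Ψ = ∑ α ∈ Finset.Nat.antidiagonalTuple t (r - 1),
      (LinearMap.mulLeft K (φ (monomial (toFS α) (1 : K)))).comp (Dop α)) :
    ∀ (d : ℕ), ∀ f ∈ homogeneousSubmodule (Fin t) K d,
      ((Dc c).comp Ψ - Ψ.comp (Dc c)) f = (d.choose (r - 1) : K) • f := by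
  intro d f hf
  have hmem : ∀ a ∈ Finset.Nat.antidiagonalTuple t (r - 1),
      monomial (toFS a) (1 : K) ∈ homogeneousSubmodule (Fin t) K (r - 1) := by
    intro a ha
    refine isHomogeneous_monomial 1 ?_
    rw [Finsupp.degree_eq_sum]
    exact Finset.Nat.mem_antidiagonalTuple.mp ha
  rw [← sum_monomial_mul_dividedPower Dop hDop (r - 1) d hf, hΨ]
  simp only [LinearMap.sub_apply, LinearMap.comp_apply, LinearMap.sum_apply,
    LinearMap.mulLeft_apply, map_sum, ← Finset.sum_sub_distrib]
  refine Finset.sum_congr rfl fun a ha => ?_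
  rw [Dc_mul, hφsplit _ (hmem a ha), dividedPower_Dc c a (Dop a) (hDop a), add_sub_cancel_right]
end
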